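/- arXiv:1908.10528 — 5 statements merged into one kernel-verified Lean document; each statement's English description precedes it below -/
import Mathlib

section
/- Let G be a finite connected simple graph, v0 a vertex of G with eccentricity D, and let the stabilizer of v0 in the automorphism group of G act on the edge set of G. Then the number of orbits of this action is at least D; in particular, G has at least D edges that are pairwise inequivalent under automorphisms of G fixing v0. -/
/-- Two edges of `G` are equivalent under the stabilizer of `v0` in the automorphism
group of `G` if some automorphism of `G` fixing `v0` maps one to the other. -/
def EdgeEquivUnderStabilizer {V : Type*} (G : SimpleGraph V) (v0 : V)
    (e e' : Sym2 V) : Prop :=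
  ∃ φ : G ≃g G, φ v0 = v0 ∧ Sym2.map φ e = e'

namespace SimpleGraph

variable {V W : Type*} {G : SimpleGraph V} {H : SimpleGraph W}

lemma Connected.dist_map_le (hG : G.Connected) (φ : G →g H) (u v : V) :
    H.dist (φ u) (φ v) ≤ G.dist u v := by
  obtain ⟨p, hp⟩ := hG.exists_walk_length_eq_dist u v
  simpa [hp] using dist_le (p.map φ)

lemma Connected.dist_iso (hG : G.Connected) (φ : G ≃g H) (u v : V) :
    H.dist (φ u) (φ v) = G.dist u v := by
  refine le_antisymm (hG.dist_map_le φ.toHom u v) ?_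
  simpa using (φ.connected_iff.mp hG).dist_map_le φ.symm.toHom (φ u) (φ v)

lemma Connected.dist_getVert_of_length_eq_dist (hG : G.Connected) {u v : V} {p : G.Walk u v}
    (hp : p.length = G.dist u v) {k : ℕ} (hk : k ≤ p.length) :
    G.dist u (p.getVert k) = k := by
  have htake := dist_le (p.take k)
  have hdrop := dist_le (p.drop k)
  have htri := hG.dist_triangle (u := u) (v := p.getVert k) (w := v)
  rw [Walk.take_length] at htake
  rw [Walk.drop_length] at hdrop
  omega

end SimpleGraph

/-- Let `G` be a finite connected simple graph, `v0` a vertex of `G` with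
eccentricity `D` (the maximum over all vertices `u` of `dist(v0,u)`), and let the
stabilizer of `v0` in the automorphism group of `G` act on the edge set of `G`.
Then the number of orbits of this action is at least `D`; in particular, `G` has at
least `D` edges that are pairwise inequivalent under automorphisms of `G` fixing
`v0`. -/
theorem num_orbits_ge_eccentricity {V : Type*} [Fintype V]
    (G : SimpleGraph V) (hconn : G.Connected) (v0 : V) (D : ℕ)
    (hecc_le : ∀ u : V, G.dist v0 u ≤ D)
    (hecc_attained : ∃ u : V, G.dist v0 u = D) :
    ∃ f : Fin D → Sym2 V, (∀ i, f i ∈ G.edgeSet) ∧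
      ∀ i j : Fin D, i ≠ j → ¬ EdgeEquivUnderStabilizer G v0 (f i) (f j) := by
  obtain ⟨u, rfl⟩ := hecc_attained
  obtain ⟨p, hp⟩ := hconn.exists_walk_length_eq_dist v0 u
  refine ⟨fun i ↦ s(p.getVert i, p.getVert (i + 1)),
    fun i ↦ p.adj_getVert_succ (i.isLt.trans_eq hp.symm), fun i j hij ⟨φ, hφ, hmap⟩ ↦ hij (Fin.ext ?_)⟩
  have hdist (k : ℕ) (hk : k ≤ p.length) : G.dist v0 (p.getVert k) = k :=
    hconn.dist_getVert_of_length_eq_dist hp hk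
  have hφdist (k : ℕ) (hk : k ≤ p.length) : G.dist v0 (φ (p.getVert k)) = k := by
    have h := hconn.dist_iso φ v0 (p.getVert k)
    rwa [hφ, hdist k hk] at h
  have hi := hφdist i (by omega)
  have hi' := hφdist (i + 1) (by omega)
  have hj := hdist j (by omega)
  have hj' := hdist (j + 1) (by omega)
  rw [Sym2.map_mk, Sym2.eq_iff] at hmap
  rcases hmap with ⟨h, h'⟩ | ⟨h, h'⟩ <;> rw [h] at hi <;> rw [h'] at hi' <;> omega
end

section
/- Let G be a connected simple graph, v0 a vertex of G, and e = {a,b} an edge of G with dist(v0,a) = dist(v0,b). Then the graph G − e obtained by deleting e is connected, and the distance from v0 to every vertex in G − e equals its distance from v0 in G. -/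
/-- If no edge in `s` joins vertices at different distances from `v`, then every vertex is joined
to `v` in `G.deleteEdges s` by a walk whose length is its distance from `v` in `G`. -/
theorem SimpleGraph.Connected.exists_deleteEdges_walk_length_eq_dist {V : Type*}
    {G : SimpleGraph V} (hconn : G.Connected) {s : Set (Sym2 V)} {v : V}
    (hs : ∀ x y, s(x, y) ∈ s → G.dist v x = G.dist v y) (u : V) :
    ∃ p : (G.deleteEdges s).Walk u v, p.length = G.dist v u := by
  induction hn : G.dist v u generalizing u with
  | zero =>
    obtain rfl := hconn.dist_eq_zero_iff.mp hn
    exact ⟨.nil, rfl⟩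
  | succ n ih =>
    obtain ⟨p, hp⟩ := hconn.exists_walk_length_eq_dist u v
    rw [G.dist_comm, hn] at hp
    cases p with
    | nil => simp at hp
    | @cons _ w _ h q =>
      rw [SimpleGraph.Walk.length_cons] at hp
      have hle : G.dist v w ≤ q.length := G.dist_comm (u := v) ▸ SimpleGraph.dist_le q
      have htri : G.dist v u ≤ G.dist v w + G.dist w u := hconn.dist_triangle
      rw [SimpleGraph.dist_eq_one_iff_adj.mpr h.symm] at htri
      have hw : G.dist v w = n := by omega
      obtain ⟨r, hr⟩ := ih w hw
      have hmem : s(u, w) ∉ s := fun hmem ↦ by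
        have := hs u w hmem
        omega
      exact ⟨.cons (SimpleGraph.deleteEdges_adj.mpr ⟨h, hmem⟩) r, by simp [hr]⟩

/-- Let `G` be a connected simple graph, `v0` a vertex of `G`, and `e = {a,b}` an
edge of `G` with `dist(v0,a) = dist(v0,b)`. Then the graph `G − e` obtained by
deleting `e` is connected, and the distance from `v0` to every vertex in `G − e`
equals its distance from `v0` in `G`. -/
theorem deleteEdge_equidistant_endpoints {V : Type*} (G : SimpleGraph V)
    (hconn : G.Connected) (v0 a b : V) (hab : G.Adj a b)
    (hdist : G.dist v0 a = G.dist v0 b) :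
    (G.deleteEdges {s(a, b)}).Connected ∧
      ∀ u : V, (G.deleteEdges {s(a, b)}).dist v0 u = G.dist v0 u := by
  have hs : ∀ x y, s(x, y) ∈ ({s(a, b)} : Set (Sym2 V)) → G.dist v0 x = G.dist v0 y := by
    intro x y hxy
    rcases Sym2.eq_iff.mp (Set.mem_singleton_iff.mp hxy) with ⟨rfl, rfl⟩ | ⟨rfl, rfl⟩
    exacts [hdist, hdist.symm]
  have hwalk := hconn.exists_deleteEdges_walk_length_eq_dist hs
  have hreach (u : V) : (G.deleteEdges {s(a, b)}).Reachable u v0 := (hwalk u).choose.reachable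
  refine ⟨(SimpleGraph.connected_iff _).mpr
    ⟨fun x y ↦ (hreach x).trans (hreach y).symm, ⟨v0⟩⟩, fun u ↦ ?_⟩
  obtain ⟨p, hp⟩ := hwalk u
  refine le_antisymm ?_ ((hreach u).symm.dist_anti (G.deleteEdges_le _))
  rw [SimpleGraph.dist_comm, ← hp]
  exact SimpleGraph.dist_le p
end

section
/- Let G be a finite connected simple cubic bridge graph on n vertices containing a triangle T that shares no edge with any other triangle of G. Then there exists a finite connected simple cubic bridge graph on n − 2 vertices. -/
/-- A finite simple graph is a cubic bridge graph if it is connected, every vertex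
has degree 3, and it contains a bridge. -/
def IsCubicBridgeGraph {V : Type*} (G : SimpleGraph V) : Prop :=
  G.Connected ∧ (∀ v : V, (G.neighborSet v).ncard = 3) ∧ ∃ e : Sym2 V, G.IsBridge e

namespace SimpleGraph

variable {V W : Type*} {G : SimpleGraph V} {f : V → W}

theorem Reachable.map_fun {u v : V} (h : G.Reachable u v) :
    (G.map f).Reachable (f u) (f v) := by
  obtain ⟨p⟩ := h
  induction p with
  | nil => exact .refl _
  | @cons u w _ huw _ ih =>
    by_cases he : f u = f w
    · rwa [he]
    · exact .trans (Adj.reachable ⟨he, u, w, huw, rfl, rfl⟩) ih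

theorem Connected.map_fun (hG : G.Connected) (hf : Function.Surjective f) :
    (G.map f).Connected := by
  have := hG.nonempty
  have : Nonempty W := .map f inferInstance
  refine ⟨fun x y => ?_⟩
  obtain ⟨u, rfl⟩ := hf x
  obtain ⟨v, rfl⟩ := hf y
  exact (hG.preconnected u v).map_fun

/-- A bridge stays a bridge under a contraction whose fibres remain connected after deleting it. -/
theorem IsBridge.map_fun {u v : V} (hb : G.IsBridge s(u, v))
    (hfib : ∀ p q, f p = f q → (G.deleteEdges {s(u, v)}).Reachable p q) :
    (G.map f).IsBridge s(f u, f v) := by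
  rw [isBridge_iff] at hb ⊢
  rintro ⟨w⟩
  refine hb ?_
  suffices h : ∀ x y, ((G.map f).deleteEdges {s(f u, f v)}).Walk x y →
      ∀ p q, f p = x → f q = y → (G.deleteEdges {s(u, v)}).Reachable p q from
    h _ _ w _ _ rfl rfl
  intro x y w
  induction w with
  | nil => intro p q hp hq; exact hfib _ _ (hp.trans hq.symm)
  | cons h _ ih =>
    intro p q hp hq
    rw [deleteEdges_adj] at h
    obtain ⟨⟨-, r, s, hrs, rfl, rfl⟩, hne⟩ := h
    refine (hfib _ _ hp).trans (.trans (Adj.reachable ?_) (ih s q rfl hq))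
    rw [deleteEdges_adj]
    refine ⟨hrs, fun h => hne ?_⟩
    have := congrArg (Sym2.map f) (Set.mem_singleton_iff.1 h)
    simpa using this

/-- Deleting a bridge does not separate vertices of a triangle. -/
theorem IsBridge.reachable_deleteEdges_of_triangle {e : Sym2 V} (he : G.IsBridge e) {a b c : V}
    (hab : G.Adj a b) (hac : G.Adj a c) (hbc : G.Adj b c) :
    (G.deleteEdges {e}).Reachable a b := by
  by_cases h : s(a, b) = e
  · subst h
    refine .trans (v := c) (Adj.reachable ?_) (Adj.reachable ?_)
    · simp [deleteEdges_adj, hac, hbc.ne', hab.ne]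
    · simp [deleteEdges_adj, hbc.symm, hac.ne', hbc.ne']
  · exact Adj.reachable (by simp [deleteEdges_adj, hab, h])

theorem exists_third_neighbor {a b c : V} (h3 : (G.neighborSet a).ncard = 3) (hab : G.Adj a b)
    (hac : G.Adj a c) (hbc : b ≠ c) :
    ∃ d, d ≠ b ∧ d ≠ c ∧ ∀ x, G.Adj a x ↔ x = b ∨ x = c ∨ x = d := by
  obtain ⟨x, y, z, hxy, hxz, hyz, hs⟩ := Set.ncard_eq_three.1 h3
  have h : ∀ w, G.Adj a w ↔ w = x ∨ w = y ∨ w = z := fun w => by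
    rw [← mem_neighborSet, hs]; simp
  have h1 := (h b).1 hab
  have h2 := (h c).1 hac
  simp only [h]
  rcases h1 with rfl | rfl | rfl <;> rcases h2 with rfl | rfl | rfl <;>
    first
    | exact absurd rfl hbc
    | exact ⟨x, by grind⟩
    | exact ⟨y, by grind⟩
    | exact ⟨z, by grind⟩

end SimpleGraph

/-- A map contracting three given vertices to one point. -/
theorem exists_contraction {V : Type*} [Fintype V] {a b c : V} (hab : a ≠ b) (hac : a ≠ c)
    (hbc : b ≠ c) :
    ∃ f : V → Fin (Fintype.card V - 2), Function.Surjective f ∧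
      ∀ p q, f p = f q ↔ p = q ∨ ((p = a ∨ p = b ∨ p = c) ∧ (q = a ∨ q = b ∨ q = c)) := by
  classical
  have hcard : Fintype.card {v // v ∉ ({b, c} : Finset V)} = Fintype.card V - 2 := by
    rw [Fintype.card_subtype_compl, Fintype.card_coe, Finset.card_pair hbc]
  let e := Fintype.equivFinOfCardEq hcard
  refine ⟨fun v => e (if h : v ∉ ({b, c} : Finset V) then ⟨v, h⟩ else ⟨a, by simp [hab, hac]⟩),
    fun x => ⟨(e.symm x).1, ?_⟩, fun p q => ?_⟩
  · dsimp only
    rw [dif_pos (e.symm x).2]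
    simp
  · rw [e.apply_eq_iff_eq, Subtype.ext_iff]
    grind

/-- Let `G` be a finite connected simple cubic bridge graph on `n` vertices
containing a triangle `{a,b,c}` that shares no edge with any other triangle of `G`.
Then there exists a finite connected simple cubic bridge graph on `n − 2`
vertices. -/
theorem isolated_triangle_reduction {V : Type*} [Fintype V]
    (G : SimpleGraph V) (n : ℕ) (hn : Fintype.card V = n)
    (hG : IsCubicBridgeGraph G)
    (a b c : V)
    (hab : G.Adj a b) (hac : G.Adj a c) (hbc : G.Adj b c)
    (hiso_ab : ∀ x : V, G.Adj a x → G.Adj b x → x = c)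
    (hiso_ac : ∀ x : V, G.Adj a x → G.Adj c x → x = b)
    (hiso_bc : ∀ x : V, G.Adj b x → G.Adj c x → x = a) :
    ∃ G' : SimpleGraph (Fin (n - 2)), IsCubicBridgeGraph G' := by
  subst hn
  obtain ⟨hconn, hdeg, e, he⟩ := hG
  obtain ⟨f, hsurj, hf⟩ := exists_contraction hab.ne hac.ne hbc.ne
  refine ⟨G.map f, hconn.map_fun hsurj, fun w => ?_, ?_⟩
  · obtain ⟨a', ha1, ha2, ha⟩ := SimpleGraph.exists_third_neighbor (hdeg a) hab hac hbc.ne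
    obtain ⟨b', hb1, hb2, hb⟩ := SimpleGraph.exists_third_neighbor (hdeg b) hab.symm hbc hac.ne
    obtain ⟨c', hc1, hc2, hc⟩ :=
      SimpleGraph.exists_third_neighbor (hdeg c) hac.symm hbc.symm hab.ne
    have hadj (x y : V) : (G.map f).Adj (f x) (f y) ↔
        f x ≠ f y ∧ ∃ p q, G.Adj p q ∧ f p = f x ∧ f q = f y := Iff.rfl
    have haa := G.loopless.irrefl a
    have hbb := G.loopless.irrefl b
    have hcc := G.loopless.irrefl c
    have hab' : a' ≠ b' := fun h => ha2 (hiso_ab a' ((ha a').2 (by simp)) ((hb a').2 (by simp [h])))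
    have hac' : a' ≠ c' := fun h => ha1 (hiso_ac a' ((ha a').2 (by simp)) ((hc a').2 (by simp [h])))
    have hbc' : b' ≠ c' := fun h => hb1 (hiso_bc b' ((hb b').2 (by simp)) ((hc b').2 (by simp [h])))
    obtain ⟨v, rfl⟩ := hsurj w
    by_cases hv : v = a ∨ v = b ∨ v = c
    · have hset : (G.map f).neighborSet (f v) = {f a', f b', f c'} := by
        ext y
        obtain ⟨y, rfl⟩ := hsurj y
        simp only [SimpleGraph.mem_neighborSet, hadj, Set.mem_insert_iff, Set.mem_singleton_iff, hf]
        constructor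
        · grind
        · rintro (h | h | h)
          · exact ⟨by grind, a, a', by grind⟩
          · exact ⟨by grind, b, b', by grind⟩
          · exact ⟨by grind, c, c', by grind⟩
      rw [hset, Set.ncard_eq_three]
      exact ⟨_, _, _, by simp only [ne_eq, hf]; grind, by simp only [ne_eq, hf]; grind,
        by simp only [ne_eq, hf]; grind, rfl⟩
    · have hset : (G.map f).neighborSet (f v) = f '' G.neighborSet v := by
        ext y
        obtain ⟨y, rfl⟩ := hsurj y
        simp only [SimpleGraph.mem_neighborSet, hadj, Set.mem_image]
        constructor
        · rintro ⟨-, p, q, hpq, hp, hq⟩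
          exact ⟨q, by grind, hq⟩
        · rintro ⟨q, hq, hqy⟩
          have := hq.ne
          exact ⟨by grind, v, q, hq, rfl, hqy⟩
      rw [hset, Set.InjOn.ncard_image, hdeg]
      intro p hp q hq hpq
      rw [SimpleGraph.mem_neighborSet, SimpleGraph.adj_comm] at hp hq
      grind
  · induction e with
    | h u v =>
      refine ⟨s(f u, f v), he.map_fun fun p q hpq => ?_⟩
      have h1 := he.reachable_deleteEdges_of_triangle hab hac hbc
      have h2 := he.reachable_deleteEdges_of_triangle hac hab hbc.symm
      have h3 := he.reachable_deleteEdges_of_triangle hbc hab.symm hac.symm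
      rcases (hf p q).1 hpq with rfl | ⟨rfl | rfl | rfl, rfl | rfl | rfl⟩ <;>
        first
        | exact .refl _
        | assumption
        | exact SimpleGraph.Reachable.symm ‹_›
end

section
/- Let G be a finite connected simple cubic bridge graph on n vertices containing two distinct triangles sharing an edge, such that the two edges joining the 4-vertex set spanned by these triangles to the rest of G have distinct endpoints outside the set, neither of these two edges is a bridge, and G has a bridge not incident to any vertex of this 4-vertex set. Then there exists a finite connected simple cubic bridge graph on n − 2 vertices. -/
namespace SimpleGraph

variable {V W : Type*}

theorem Reachable.of_forall_adj_reachable {G : SimpleGraph V} {H : SimpleGraph W} (f : V → W)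
    (hf : ∀ s t, G.Adj s t → H.Reachable (f s) (f t)) {s t : V} (h : G.Reachable s t) :
    H.Reachable (f s) (f t) := by
  obtain ⟨p⟩ := h
  induction p with
  | nil => exact .refl _
  | cons hst _ ih => exact (hf _ _ hst).trans ih

theorem Reachable.iff_of_forall_adj_iff {G : SimpleGraph V} (S : V → Prop)
    (hS : ∀ s t, G.Adj s t → (S s ↔ S t)) {s t : V} (h : G.Reachable s t) : S s ↔ S t := by
  obtain ⟨p⟩ := h
  induction p with
  | nil => rfl
  | cons hst _ ih => exact (hS _ _ hst).trans ih

theorem mem_triple_of_adj {G : SimpleGraph V} {s p q r t : V}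
    (h : (G.neighborSet s).ncard = 3) (hp : G.Adj s p) (hq : G.Adj s q) (hr : G.Adj s r)
    (hpq : p ≠ q) (hpr : p ≠ r) (hqr : q ≠ r) (ht : G.Adj s t) : t = p ∨ t = q ∨ t = r := by
  have hsub : ({p, q, r} : Set V) ⊆ G.neighborSet s := by
    rintro z (rfl | rfl | rfl) <;> assumption
  have heq := Set.eq_of_subset_of_ncard_le hsub
    (by rw [h, Set.ncard_eq_three.2 ⟨p, q, r, hpq, hpr, hqr, rfl⟩])
    (Set.finite_of_ncard_ne_zero (by omega))
  have : t ∈ ({p, q, r} : Set V) := heq ▸ ht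
  simpa using this

/-- The vertex `c` is reattached to `x`, `y` and `d`, while `d` subdivides the edge `uv` and
is joined to `c`. -/
def reattach (G : SimpleGraph V) (c d x y u v : V) : SimpleGraph V :=
  fromRel fun s t ↦
    (G.Adj s t ∧ s ≠ c ∧ s ≠ d ∧ t ≠ c ∧ t ≠ d ∧ s(s, t) ≠ s(u, v)) ∨
    (s = c ∧ (t = x ∨ t = y ∨ t = d)) ∨ (s = d ∧ (t = u ∨ t = v))

end SimpleGraph

theorem IsCubicBridgeGraph.of_iso {V W : Type*} {G : SimpleGraph V} {H : SimpleGraph W}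
    (φ : G ≃g H) (hG : IsCubicBridgeGraph G) : IsCubicBridgeGraph H := by
  obtain ⟨hconn, hdeg, e, he⟩ := hG
  refine ⟨φ.connected_iff.1 hconn, fun w ↦ ?_, ?_⟩
  · rw [← hdeg (φ.symm w)]
    exact Set.ncard_congr' (φ.symm.mapNeighborSet w)
  · induction e with | h u v =>
    refine ⟨s(φ u, φ v), fun h ↦ he ?_⟩
    have := h.of_forall_adj_reachable (H := G.deleteEdges {s(u, v)}) φ.symm fun s t hst ↦ by
      apply SimpleGraph.Adj.reachable
      rw [SimpleGraph.deleteEdges_adj] at hst ⊢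
      refine ⟨φ.symm.map_adj_iff.2 hst.1, fun h' ↦ hst.2 ?_⟩
      have := congrArg (Sym2.map φ) (Set.mem_singleton_iff.1 h')
      simpa using this
    simpa using this

open SimpleGraph in
/-- Replacing a diamond `{a, b, c, d}` by two vertices that subdivide a bridge and the edge
joining the two attachment vertices. -/
theorem IsCubicBridgeGraph.induce_reattach {V : Type*} {G : SimpleGraph V}
    (hconn : G.Connected) (hdeg : ∀ v : V, (G.neighborSet v).ncard = 3)
    {a b c d x y u v : V} (hcd : c ≠ d) (hca : c ≠ a) (hcb : c ≠ b) (hda : d ≠ a) (hdb : d ≠ b)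
    (hxa : x ≠ a) (hxb : x ≠ b) (hxc : x ≠ c) (hxd : x ≠ d)
    (hya : y ≠ a) (hyb : y ≠ b) (hyc : y ≠ c) (hyd : y ≠ d) (hxy : x ≠ y)
    (hua : u ≠ a) (hub : u ≠ b) (huc : u ≠ c) (hud : u ≠ d)
    (hva : v ≠ a) (hvb : v ≠ b) (hvc : v ≠ c) (hvd : v ≠ d)
    (hac : G.Adj a c) (had : G.Adj a d) (hcx : G.Adj c x) (hdy : G.Adj d y)
    (hNa : ∀ t, G.Adj a t → t = b ∨ t = c ∨ t = d)
    (hNb : ∀ t, G.Adj b t → t = a ∨ t = c ∨ t = d)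
    (hNc : ∀ t, G.Adj c t → t = a ∨ t = b ∨ t = x)
    (hNd : ∀ t, G.Adj d t → t = a ∨ t = b ∨ t = y)
    (huv : G.Adj u v) (hbr : G.IsBridge s(u, v))
    (hvc_sep : ¬ (G.deleteEdges {s(u, v)}).Reachable v c) :
    IsCubicBridgeGraph ((G.reattach c d x y u v).induce {z | z ≠ a ∧ z ≠ b}) := by
  classical
  let c' : {z | z ≠ a ∧ z ≠ b} := ⟨c, hca, hcb⟩
  let d' : {z | z ≠ a ∧ z ≠ b} := ⟨d, hda, hdb⟩
  let x' : {z | z ≠ a ∧ z ≠ b} := ⟨x, hxa, hxb⟩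
  let y' : {z | z ≠ a ∧ z ≠ b} := ⟨y, hya, hyb⟩
  let u' : {z | z ≠ a ∧ z ≠ b} := ⟨u, hua, hub⟩
  let v' : {z | z ≠ a ∧ z ≠ b} := ⟨v, hva, hvb⟩
  have huv_ne : u ≠ v := huv.ne
  have hsymm : ∀ s t, G.Adj s t → G.Adj t s := fun _ _ ↦ Adj.symm
  set H := (G.reattach c d x y u v).induce {z | z ≠ a ∧ z ≠ b} with hH
  have hadj (s t : {z | z ≠ a ∧ z ≠ b}) : H.Adj s t ↔ (G.reattach c d x y u v).Adj s t := .rfl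
  have hcx' : H.Adj c' x' := by simp [hadj, reattach, c', x']; grind
  have hcy' : H.Adj c' y' := by simp [hadj, reattach, c', y']; grind
  have hcd' : H.Adj c' d' := by simp [hadj, reattach, c', d']; grind
  have hdu' : H.Adj d' u' := by simp [hadj, reattach, d', u']; grind
  have hdv' : H.Adj d' v' := by simp [hadj, reattach, d', v']; grind
  refine ⟨?_, ?_, s(d', v'), ?_⟩
  · let f (s : V) : {z | z ≠ a ∧ z ≠ b} :=
      if h : s ≠ a ∧ s ≠ b ∧ s ≠ c ∧ s ≠ d then ⟨s, h.1, h.2.1⟩ else c'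
    have hf : ∀ s t, G.Adj s t → H.Reachable (f s) (f t) := by
      intro s t hst
      by_cases hs : s ≠ a ∧ s ≠ b ∧ s ≠ c ∧ s ≠ d <;> by_cases ht : t ≠ a ∧ t ≠ b ∧ t ≠ c ∧ t ≠ d
      · rw [show f s = ⟨s, hs.1, hs.2.1⟩ from dif_pos hs,
          show f t = ⟨t, ht.1, ht.2.1⟩ from dif_pos ht]
        by_cases he : s(s, t) = s(u, v)
        · rcases Sym2.eq_iff.1 he with ⟨rfl, rfl⟩ | ⟨rfl, rfl⟩
          · exact hdu'.symm.reachable.trans hdv'.reachable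
          · exact hdv'.symm.reachable.trans hdu'.reachable
        · refine Adj.reachable ((hadj _ _).2 ((fromRel_adj _ _ _).2 ⟨hst.ne, Or.inl (Or.inl ?_)⟩))
          exact ⟨hst, hs.2.2.1, hs.2.2.2, ht.2.2.1, ht.2.2.2, he⟩
      · rw [show f s = ⟨s, hs.1, hs.2.1⟩ from dif_pos hs, show f t = c' from dif_neg ht]
        have : s = x ∨ s = y := by grind
        rcases this with rfl | rfl
        · exact hcx'.symm.reachable
        · exact hcy'.symm.reachable
      · rw [show f t = ⟨t, ht.1, ht.2.1⟩ from dif_pos ht, show f s = c' from dif_neg hs]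
        have : t = x ∨ t = y := by grind
        rcases this with rfl | rfl
        · exact hcx'.reachable
        · exact hcy'.reachable
      · rw [show f t = c' from dif_neg ht, show f s = c' from dif_neg hs]
    have hfc (s : {z | z ≠ a ∧ z ≠ b}) : H.Reachable s c' := by
      by_cases hd : s = d'
      · exact hd ▸ hcd'.symm.reachable
      · have := (hconn.preconnected s c).of_forall_adj_reachable f hf
        have hs : f s = s := by grind
        have hc : f c = c' := by grind
        rwa [hs, hc] at this
    have : Nonempty {z | z ≠ a ∧ z ≠ b} := ⟨c'⟩
    exact ⟨fun s t ↦ (hfc s).trans (hfc t).symm⟩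
  · intro s
    by_cases hsc : s = c'
    · refine Set.ncard_eq_three.2 ⟨x', y', d', ?_, ?_, ?_, ?_⟩
      · grind
      · grind
      · grind
      · ext t
        simp only [mem_neighborSet, hadj, reattach, fromRel_adj]
        grind
    by_cases hsd : s = d'
    · refine Set.ncard_eq_three.2 ⟨u', v', c', ?_, ?_, ?_, ?_⟩
      · grind
      · grind
      · grind
      · ext t
        simp only [mem_neighborSet, hadj, reattach, fromRel_adj]
        grind
    obtain ⟨s, hsa, hsb⟩ := s
    replace hsc : s ≠ c := fun h ↦ hsc (Subtype.ext h)
    replace hsd : s ≠ d := fun h ↦ hsd (Subtype.ext h)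
    rw [← hdeg s]
    symm
    have key : ∀ t, G.Adj s t → t ≠ a ∧ t ≠ b := by
      intro t hst
      constructor <;> rintro rfl <;> grind
    have key_c : ∀ t, G.Adj s t → t = c → s = x := by
      rintro t hst rfl
      grind
    have key_d : ∀ t, G.Adj s t → t = d → s = y := by
      rintro t hst rfl
      grind
    refine Set.ncard_congr (fun t ht ↦ if t = c ∨ t = d then c' else
      if s(s, t) = s(u, v) then d' else ⟨t, key t ht⟩) ?_ ?_ ?_
    · intro t ht
      replace ht : G.Adj s t := ht
      have := ht.ne
      have h_c := key_c t ht
      have h_d := key_d t ht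
      split_ifs with h₁ h₂ <;>
        simp only [mem_neighborSet, hadj, reattach, fromRel_adj, c', d']
      · grind
      · rw [Sym2.eq_iff] at h₂
        grind
      · grind
    · intro t₁ t₂ h₁ h₂ h
      have h_c₁ := key_c t₁ h₁
      have h_d₁ := key_d t₁ h₁
      have h_c₂ := key_c t₂ h₂
      have h_d₂ := key_d t₂ h₂
      replace h := congrArg Subtype.val h
      split_ifs at h <;> simp only [c', d', Sym2.eq_iff] at * <;> grind
    · rintro ⟨t, hta, htb⟩ ht
      simp only [mem_neighborSet, hadj, reattach, fromRel_adj] at ht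
      simp only [mem_neighborSet]
      by_cases htc : t = c
      · have : s = x ∨ s = y := by grind
        rcases this with rfl | rfl
        · exact ⟨c, hcx.symm, by simp [c', htc]⟩
        · exact ⟨d, hdy.symm, by simp [c', htc]⟩
      by_cases htd : t = d
      · have : s = u ∨ s = v := by grind
        rcases this with rfl | rfl
        · exact ⟨v, huv, by simp [d', htd, hvc, hvd]⟩
        · exact ⟨u, huv.symm, by simp [d', htd, huc, hud, Sym2.eq_swap]⟩
      · have : G.Adj s t ∧ s(s, t) ≠ s(u, v) := by
          have := Sym2.eq_swap (a := s) (b := t)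
          grind
        exact ⟨t, this.1, by simp only [htc, htd, this.2, or_self, if_false]⟩
  · let S (s : V) : Prop := (G.deleteEdges {s(u, v)}).Reachable v s
    have hS : ∀ s t, G.Adj s t → s(s, t) ≠ s(u, v) → (S s ↔ S t) := by
      intro s t hst hne
      have hr : (G.deleteEdges {s(u, v)}).Reachable s t :=
        Adj.reachable (deleteEdges_adj.2 ⟨hst, hne⟩)
      exact ⟨fun h ↦ h.trans hr, fun h ↦ h.trans hr.symm⟩
    have hSu : ¬ S u := fun h ↦ hbr h.symm
    have hSc : ¬ S c := hvc_sep
    have hSa : ¬ S a := by rwa [hS a c hac (by simp; grind)]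
    have hSd : ¬ S d := by rwa [← hS a d had (by simp; grind)]
    have hSx : ¬ S x := by rwa [← hS c x hcx (by simp; grind)]
    have hSy : ¬ S y := by rwa [← hS d y hdy (by simp; grind)]
    intro h
    have := h.iff_of_forall_adj_iff (fun s ↦ S s.1) fun s t hst ↦ by
      simp only [deleteEdges_adj, hadj, reattach, fromRel_adj, Set.mem_singleton_iff] at hst
      obtain ⟨⟨hne, hst⟩, hne'⟩ := hst
      have hdv_ne : ¬ (s.1 = d ∧ t.1 = v ∨ s.1 = v ∧ t.1 = d) := by
        rintro (⟨h₁, h₂⟩ | ⟨h₁, h₂⟩)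
        · exact hne' (by rw [show s = d' from Subtype.ext h₁, show t = v' from Subtype.ext h₂])
        · exact hne' (by
            rw [show s = v' from Subtype.ext h₁, show t = d' from Subtype.ext h₂, Sym2.eq_swap])
      have h₁ := hS s.1 t.1
      have h₂ := hS t.1 s.1
      clear_value S
      grind
    exact hSd (this.2 (Reachable.refl v))

/-- Let `G` be a finite connected simple cubic bridge graph on `n` vertices
containing two distinct triangles `{a,b,c}` and `{a,b,d}` sharing the edge `{a,b}`,
such that the two edges joining the 4-vertex set `{a,b,c,d}` spanned by these
triangles to the rest of `G` have distinct endpoints outside the set, neither of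
these two edges is a bridge, and `G` has a bridge not incident to any vertex of
this 4-vertex set. Then there exists a finite connected simple cubic bridge graph
on `n − 2` vertices. -/
theorem adjacent_triangles_reduction {V : Type*} [Fintype V]
    (G : SimpleGraph V) (n : ℕ) (hn : Fintype.card V = n)
    (hG : IsCubicBridgeGraph G)
    (a b c d : V)
    (hab : G.Adj a b) (hac : G.Adj a c) (hbc : G.Adj b c)
    (had : G.Adj a d) (hbd : G.Adj b d) (hcd : c ≠ d)
    (x y : V)
    (hx : x ∉ ({a, b, c, d} : Set V)) (hy : y ∉ ({a, b, c, d} : Set V))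
    (hcx : G.Adj c x) (hdy : G.Adj d y) (hxy : x ≠ y)
    (hcx_nb : ¬ G.IsBridge s(c, x)) (hdy_nb : ¬ G.IsBridge s(d, y))
    (hbridge : ∃ e : Sym2 V, G.IsBridge e ∧
      ∀ u ∈ ({a, b, c, d} : Set V), u ∉ e) :
    ∃ G' : SimpleGraph (Fin (n - 2)), IsCubicBridgeGraph G' := by
  obtain ⟨hconn, hdeg, -⟩ := hG
  obtain ⟨e, he, hinc⟩ := hbridge
  simp only [Set.mem_insert_iff, Set.mem_singleton_iff, not_or, forall_eq_or_imp, forall_eq]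
    at hx hy hinc
  suffices h : ∃ u v, s(u, v) = e ∧ ¬ (G.deleteEdges {s(u, v)}).Reachable v c by
    obtain ⟨u, v, rfl, hsep⟩ := h
    simp only [Sym2.mem_iff, not_or] at hinc
    have huv : G.Adj u v := he.reachable_iff_adj.1 (hconn.preconnected u v)
    have key := IsCubicBridgeGraph.induce_reattach (a := a) (b := b) (d := d) (x := x) (y := y)
      hconn hdeg hcd hac.ne' hbc.ne' had.ne' hbd.ne' hx.1 hx.2.1 hx.2.2.1 hx.2.2.2
      hy.1 hy.2.1 hy.2.2.1 hy.2.2.2 hxy (Ne.symm hinc.1.1) (Ne.symm hinc.2.1.1)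
      (Ne.symm hinc.2.2.1.1) (Ne.symm hinc.2.2.2.1) (Ne.symm hinc.1.2) (Ne.symm hinc.2.1.2)
      (Ne.symm hinc.2.2.1.2) (Ne.symm hinc.2.2.2.2) hac had hcx hdy
      (fun t ↦ SimpleGraph.mem_triple_of_adj (hdeg a) hab hac had hbc.ne hbd.ne hcd)
      (fun t ↦ SimpleGraph.mem_triple_of_adj (hdeg b) hab.symm hbc hbd hac.ne had.ne hcd)
      (fun t ↦ SimpleGraph.mem_triple_of_adj (hdeg c) hac.symm hbc.symm hcx hab.ne
        (Ne.symm hx.1) (Ne.symm hx.2.1))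
      (fun t ↦ SimpleGraph.mem_triple_of_adj (hdeg d) had.symm hbd.symm hdy hab.ne
        (Ne.symm hy.1) (Ne.symm hy.2.1))
      huv he hsep
    classical
    have hcard : Fintype.card {z | z ≠ a ∧ z ≠ b} = n - 2 := by
      rw [← Set.toFinset_card, ← hn, ← Finset.card_pair hab.ne, ← Finset.card_compl]
      congr 1
      ext z; simp
    exact ⟨_, key.of_iso (SimpleGraph.overFinIso _ hcard)⟩
  induction e with | h u v =>
  by_cases hv : (G.deleteEdges {s(u, v)}).Reachable v c
  · refine ⟨v, u, Sym2.eq_swap, fun hu ↦ he ?_⟩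
    rw [Sym2.eq_swap] at hu
    exact hu.trans hv.symm
  · exact ⟨u, v, rfl, hv⟩
end

section
/- For every natural number M there exists N such that for all n ≥ N: if there exists a finite connected simple cubic graph on n vertices that has no bridges and contains two edges whose joint deletion disconnects it, then there exist at least M pairwise non-isomorphic finite connected simple cubic bridge graphs on n + 4 vertices. -/
/-- The arcs `u → v` with `u < v` of a chain-shaped cubic graph on `{0, …, 4x + 2s + 5}`: a
Hamiltonian path together with chords forming an end block on `{0, …, 4}`, then `x` diamonds, then
a triangle-free end block on the last `2s + 1` vertices. -/
def diamondChainRel (x s u v : ℕ) : Prop :=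
  v = u + 1 ∨ (u = 0 ∧ v = 4) ∨ (u < 2 ∧ v = u + 2) ∨
    (5 ≤ u ∧ u < 5 + 4 * x ∧ (u % 4 = 1 ∨ u % 4 = 2) ∧ v = u + 2) ∨
    (5 + 4 * x < u ∧ u ≤ 5 + 4 * x + s ∧ v = u + s) ∨
    (u = 5 + 4 * x ∧ v = 5 + 4 * x + 2 * s)

/-- The graph on `Fin m` whose edges are given by `diamondChainRel`; it is intended for
`m = 4x + 2s + 6`. -/
def diamondChain (m x s : ℕ) : SimpleGraph (Fin m) :=
  SimpleGraph.fromRel fun u v => diamondChainRel x s u v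

theorem diamondChainRel_of_succ {x s u v : ℕ} (h : u + 1 = v ∨ v + 1 = u) :
    u ≠ v ∧ (diamondChainRel x s u v ∨ diamondChainRel x s v u) :=
  ⟨by omega, h.imp (fun h => Or.inl h.symm) (fun h => Or.inl h.symm)⟩

theorem diamondChainRel_of_add_two {x s u v : ℕ}
    (h : u + 2 = v ∧ (u < 2 ∨ 5 ≤ u ∧ u < 5 + 4 * x ∧ (u % 4 = 1 ∨ u % 4 = 2)) ∨
      v + 2 = u ∧ (v < 2 ∨ 5 ≤ v ∧ v < 5 + 4 * x ∧ (v % 4 = 1 ∨ v % 4 = 2))) :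
    u ≠ v ∧ (diamondChainRel x s u v ∨ diamondChainRel x s v u) := by
  refine ⟨by omega, h.imp ?_ ?_⟩ <;>
  · rintro ⟨rfl, h | ⟨h₁, h₂, h₃⟩⟩
    · exact Or.inr (Or.inr (Or.inl ⟨h, rfl⟩))
    · exact Or.inr (Or.inr (Or.inr (Or.inl ⟨h₁, h₂, h₃, rfl⟩)))

theorem diamondChainRel_of_end {x s u v : ℕ} (hs : 3 ≤ s)
    (h : u = 0 ∧ v = 4 ∨ 5 + 4 * x < u ∧ u ≤ 5 + 4 * x + s ∧ v = u + s ∨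
      u = 5 + 4 * x ∧ v = 5 + 4 * x + 2 * s) :
    u ≠ v ∧ (diamondChainRel x s u v ∨ diamondChainRel x s v u) := by
  refine ⟨by omega, Or.inl ?_⟩
  rcases h with h | h | h
  · exact Or.inr (Or.inl h)
  · exact Or.inr (Or.inr (Or.inr (Or.inr (Or.inl h))))
  · exact Or.inr (Or.inr (Or.inr (Or.inr (Or.inr h))))

theorem diamondChain_adj {m x s : ℕ} {u v : Fin m} :
    (diamondChain m x s).Adj u v ↔
      (u : ℕ) ≠ v ∧ (diamondChainRel x s u v ∨ diamondChainRel x s v u) := by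
  simp [diamondChain, Fin.ext_iff]

theorem diamondChain_connected {m x s : ℕ} (hm : 0 < m) : (diamondChain m x s).Connected := by
  have reach : ∀ k (hk : k < m), (diamondChain m x s).Reachable ⟨0, hm⟩ ⟨k, hk⟩ := by
    intro k
    induction k with
    | zero => exact fun _ => SimpleGraph.Reachable.refl _
    | succ k ih =>
      intro hk
      refine (ih (by omega)).trans (SimpleGraph.Adj.reachable ?_)
      exact diamondChain_adj.2 ⟨by simp, Or.inl (Or.inl rfl)⟩
  have : Nonempty (Fin m) := ⟨⟨0, hm⟩⟩
  exact ⟨fun u v => (reach u u.2).symm.trans (reach v v.2)⟩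

/-- The three neighbours of a vertex in `diamondChain`. -/
def diamondChainNeighbors (x s v : ℕ) : ℕ × ℕ × ℕ :=
  if v = 0 then (1, 2, 4)
  else if v = 1 then (0, 2, 3)
  else if v = 2 then (1, 3, 0)
  else if v = 3 then (2, 4, 1)
  else if v = 4 then (3, 5, 0)
  else if v < 5 + 4 * x then
    if v % 4 = 1 ∨ v % 4 = 2 then (v - 1, v + 1, v + 2) else (v - 1, v + 1, v - 2)
  else if v = 5 + 4 * x then (v - 1, v + 1, v + 2 * s)
  else if v ≤ 5 + 4 * x + s then (v - 1, v + 1, v + s)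
  else if v < 5 + 4 * x + 2 * s then (v - 1, v + 1, v - s)
  else (v - 1, v - s, v - 2 * s)

theorem diamondChain_neighborSet_ncard {m x s : ℕ} (hs : 3 ≤ s) (hm : m = 4 * x + 2 * s + 6)
    (v : Fin m) : ((diamondChain m x s).neighborSet v).ncard = 3 := by
  obtain ⟨v, hv⟩ := v
  obtain ⟨a, b, c, habc⟩ : ∃ a b c, diamondChainNeighbors x s v = (a, b, c) := ⟨_, _, _, rfl⟩
  have key : a < m ∧ b < m ∧ c < m ∧ a ≠ b ∧ a ≠ c ∧ b ≠ c ∧ ∀ w < m,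
      (v ≠ w ∧ (diamondChainRel x s v w ∨ diamondChainRel x s w v)) ↔
        (w = a ∨ w = b ∨ w = c) := by
    unfold diamondChainNeighbors at habc
    split_ifs at habc <;> simp only [Prod.mk.injEq] at habc <;> obtain ⟨rfl, rfl, rfl⟩ := habc <;>
      refine ⟨by omega, by omega, by omega, by omega, by omega, by omega, fun w hw => ⟨?_, ?_⟩⟩
    all_goals first
      | rintro ⟨_, (h | h | h | h | h | h) | (h | h | h | h | h | h)⟩ <;> omega
      | rintro (rfl | rfl | rfl) <;> first
        | exact diamondChainRel_of_succ (by omega)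
        | exact diamondChainRel_of_add_two (by omega)
        | exact diamondChainRel_of_end hs (by omega)
        | exact (diamondChainRel_of_end hs (by omega)).imp Ne.symm Or.symm
  obtain ⟨ha, hb, hc, hab, hac, hbc, hadj⟩ := key
  refine Set.ncard_eq_three.2 ⟨⟨a, ha⟩, ⟨b, hb⟩, ⟨c, hc⟩, by simpa, by simpa, by simpa, ?_⟩
  ext ⟨w, hw⟩
  simpa [diamondChain_adj] using hadj w hw

theorem diamondChain_isBridge {m x s : ℕ} (hs : 3 ≤ s) (hm : m = 4 * x + 2 * s + 6) :
    (diamondChain m x s).IsBridge s(⟨4, by omega⟩, ⟨5, by omega⟩) := by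
  rw [SimpleGraph.isBridge_iff]
  have closed : ∀ u v : Fin m, ((diamondChain m x s).deleteEdges
      {s(⟨4, by omega⟩, ⟨5, by omega⟩)}).Walk u v → (u : ℕ) ≤ 4 → (v : ℕ) ≤ 4 := by
    intro u v p
    induction p with
    | nil => exact id
    | @cons u w _ h _ ih =>
      refine fun hu => ih ?_
      simp only [SimpleGraph.deleteEdges_adj, diamondChain_adj, diamondChainRel,
        Set.mem_singleton_iff, Sym2.eq_iff, Fin.ext_iff] at h
      obtain ⟨⟨_, (h | h | h | h | h | h) | (h | h | h | h | h | h)⟩, hne⟩ := h <;> omega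
  rintro ⟨p⟩
  exact absurd (closed _ _ p le_rfl) (by simp)

/-- The vertices of `G` lying on a triangle. -/
def SimpleGraph.triangleVertices {V : Type*} (G : SimpleGraph V) : Set V :=
  {v | ∃ a b, G.Adj v a ∧ G.Adj v b ∧ G.Adj a b}

theorem SimpleGraph.Iso.ncard_triangleVertices {V W : Type*} {G : SimpleGraph V}
    {H : SimpleGraph W} (e : G ≃g H) : G.triangleVertices.ncard = H.triangleVertices.ncard := by
  have : e '' G.triangleVertices = H.triangleVertices := by
    ext w
    constructor
    · rintro ⟨v, ⟨a, b, h₁, h₂, h₃⟩, rfl⟩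
      exact ⟨e a, e b, e.map_adj_iff.2 h₁, e.map_adj_iff.2 h₂, e.map_adj_iff.2 h₃⟩
    · rintro ⟨a, b, h₁, h₂, h₃⟩
      exact ⟨e.symm w, ⟨e.symm a, e.symm b, e.symm.map_adj_iff.2 h₁, e.symm.map_adj_iff.2 h₂,
        e.symm.map_adj_iff.2 h₃⟩, e.apply_symm_apply w⟩
  rw [← this, Set.ncard_image_of_injective _ e.injective]

theorem mem_triangleVertices_diamondChain {m x s : ℕ} (hs : 3 ≤ s) (hm : m = 4 * x + 2 * s + 6)
    (v : Fin m) : v ∈ (diamondChain m x s).triangleVertices ↔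
      (v : ℕ) ≤ 3 ∨ (5 ≤ (v : ℕ) ∧ (v : ℕ) < 5 + 4 * x) := by
  obtain ⟨v, hv⟩ := v
  simp only [SimpleGraph.triangleVertices, Set.mem_ofPred_eq, diamondChain_adj]
  constructor
  · rintro ⟨⟨a, ha⟩, ⟨b, hb⟩, h₁, h₂, h₃⟩
    dsimp only at h₁ h₂ h₃
    by_contra hcon
    have neighbors : ∀ w, v ≠ w ∧ (diamondChainRel x s v w ∨ diamondChainRel x s w v) →
        w + 1 = v ∨ w = v + 1 ∨ (v = 4 ∧ w = 0) ∨ (v = 5 + 4 * x ∧ w = v + 2 * s) ∨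
        (w = 5 + 4 * x ∧ v = w + 2 * s) ∨ (5 + 4 * x < v ∧ v ≤ 5 + 4 * x + s ∧ w = v + s) ∨
        (5 + 4 * x + s < v ∧ v = w + s) := by
      rintro w ⟨_, (h | h | h | h | h | h) | (h | h | h | h | h | h)⟩ <;> omega
    replace h₁ := neighbors a h₁
    replace h₂ := neighbors b h₂
    obtain ⟨hab, h₃⟩ := h₃
    clear neighbors
    rcases h₁ with h | h | h | h | h | h | h <;> rcases h₂ with h' | h' | h' | h' | h' | h' | h' <;>
      first
      | omega
      | rcases h₃ with (h | h | h | h | h | h) | (h | h | h | h | h | h) <;> omega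
  · intro h
    have hcase : v = 0 ∨ v = 1 ∨ v = 2 ∨ v = 3 ∨ (5 ≤ v ∧ v < 5 + 4 * x ∧ v % 4 = 1) ∨
      (5 ≤ v ∧ v < 5 + 4 * x ∧ v % 4 = 2) ∨ (5 ≤ v ∧ v < 5 + 4 * x ∧ v % 4 = 3) ∨
      (5 ≤ v ∧ v < 5 + 4 * x ∧ v % 4 = 0) := by omega
    rcases hcase with h | h | h | h | h | h | h | h
    on_goal 8 => refine ⟨⟨v - 1, by omega⟩, ⟨v - 2, by omega⟩, ?_, ?_, ?_⟩
    on_goal 7 => refine ⟨⟨v - 1, by omega⟩, ⟨v - 2, by omega⟩, ?_, ?_, ?_⟩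
    on_goal 6 => refine ⟨⟨v - 1, by omega⟩, ⟨v + 1, by omega⟩, ?_, ?_, ?_⟩
    on_goal 5 => refine ⟨⟨v + 1, by omega⟩, ⟨v + 2, by omega⟩, ?_, ?_, ?_⟩
    on_goal 4 => refine ⟨⟨1, by omega⟩, ⟨2, by omega⟩, ?_, ?_, ?_⟩
    on_goal 3 => refine ⟨⟨0, by omega⟩, ⟨1, by omega⟩, ?_, ?_, ?_⟩
    on_goal 2 => refine ⟨⟨0, by omega⟩, ⟨2, by omega⟩, ?_, ?_, ?_⟩
    on_goal 1 => refine ⟨⟨1, by omega⟩, ⟨2, by omega⟩, ?_, ?_, ?_⟩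
    all_goals first
      | exact diamondChainRel_of_succ (by dsimp only; omega)
      | exact diamondChainRel_of_add_two (by dsimp only; omega)

theorem diamondChain_not_iso {m x s y t : ℕ} (hs : 3 ≤ s) (hm : m = 4 * x + 2 * s + 6)
    (ht : 3 ≤ t) (hm' : m = 4 * y + 2 * t + 6) (hxy : x < y) :
    IsEmpty (diamondChain m x s ≃g diamondChain m y t) := by
  refine ⟨fun e => e.ncard_triangleVertices.not_lt (Set.ncard_lt_ncard ?_)⟩
  refine (Set.ssubset_iff_of_subset fun v hv => ?_).2 ⟨⟨5 + 4 * x, by omega⟩, ?_, ?_⟩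
  · rw [mem_triangleVertices_diamondChain hs hm] at hv
    rw [mem_triangleVertices_diamondChain ht hm']
    omega
  · rw [mem_triangleVertices_diamondChain ht hm']
    dsimp only
    omega
  · rw [mem_triangleVertices_diamondChain hs hm]
    dsimp only
    omega

theorem SimpleGraph.even_card_of_ncard_neighborSet_eq_three {V : Type*} [Fintype V]
    (G : SimpleGraph V) (h : ∀ v, (G.neighborSet v).ncard = 3) : Even (Fintype.card V) := by
  classical
  have hdeg : ∀ v, G.degree v = 3 := fun v => by
    rw [← h v, ← G.card_neighborSet_eq_degree, Set.ncard_eq_toFinset_card', Set.toFinset_card]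
  have hsum := G.sum_degrees_eq_twice_card_edges
  simp only [hdeg, Finset.sum_const, Finset.card_univ, smul_eq_mul] at hsum
  rw [Nat.even_iff]
  omega


/-- For every natural number `M` there exists `N` such that for all `n ≥ N`: if
there exists a finite connected simple cubic graph on `n` vertices that has no
bridges and contains two edges whose joint deletion disconnects it (a bi-bridge),
then there exist at least `M` pairwise non-isomorphic finite connected simple cubic
bridge graphs on `n + 4` vertices. -/
theorem many_bridge_graphs_from_biconnected :
    ∀ M : ℕ, ∃ N : ℕ, ∀ n : ℕ, N ≤ n →
      (∃ G : SimpleGraph (Fin n), G.Connected ∧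
          (∀ v : Fin n, (G.neighborSet v).ncard = 3) ∧
          (∀ e : Sym2 (Fin n), ¬ G.IsBridge e) ∧
          ∃ e₁ ∈ G.edgeSet, ∃ e₂ ∈ G.edgeSet, e₁ ≠ e₂ ∧
            ¬ (G.deleteEdges {e₁, e₂}).Connected) →
      ∃ f : Fin M → SimpleGraph (Fin (n + 4)),
        (∀ i, IsCubicBridgeGraph (f i)) ∧
        ∀ i j : Fin M, i ≠ j → ¬ Nonempty (f i ≃g f j) := by
  intro M
  refine ⟨4 * M + 8, fun n hn ⟨G, _, hcubic, _⟩ => ?_⟩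
  have hn_even : n % 2 = 0 := by
    simpa [Nat.even_iff] using G.even_card_of_ncard_neighborSet_eq_three hcubic
  let s : Fin M → ℕ := fun i => (n - 2 - 4 * i) / 2
  have hs : ∀ i, 3 ≤ s i ∧ n + 4 = 4 * i + 2 * s i + 6 := fun i => by
    have := i.2
    dsimp only [s]
    omega
  refine ⟨fun i => diamondChain (n + 4) i (s i), fun i =>
    ⟨diamondChain_connected (by omega), diamondChain_neighborSet_ncard (hs i).1 (hs i).2,
      _, diamondChain_isBridge (hs i).1 (hs i).2⟩, ?_⟩
  rintro i j hij ⟨e⟩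
  rcases lt_or_gt_of_ne hij with h | h
  · exact (diamondChain_not_iso (hs i).1 (hs i).2 (hs j).1 (hs j).2 h).false e
  · exact (diamondChain_not_iso (hs j).1 (hs j).2 (hs i).1 (hs i).2 h).false e.symm
end
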